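/- Every strongly balanced tiling 𝔗 of the plane by isometric copies of a single convex pentagon contains a vertex of valence 3; indeed w₃(𝔗) > 0, where w₃(𝔗) = v₃(𝔗)/v(𝔗) and v(𝔗) = Σ_{j≥3} v_j(𝔗). -/

import Mathlib

open Filter Metric

noncomputable section

/-- The Euclidean plane ℝ². -/
abbrev Plane : Type := EuclideanSpace ℝ (Fin 2)

/-- A tiling of the plane: a countable family of closed sets (tiles) whose union is
all of ℝ² and whose interiors are pairwise disjoint. -/
structure PlaneTiling where
  tiles : Set (Set Plane)
  countable : tiles.Countable
  closed : ∀ t ∈ tiles, IsClosed t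
  covers : ⋃₀ tiles = Set.univ
  interiors_disjoint : ∀ t₁ ∈ tiles, ∀ t₂ ∈ tiles, t₁ ≠ t₂ → interior t₁ ∩ interior t₂ = ∅

/-- A tiling is monohedral by a prototile `P` if every tile is an isometric copy of `P`. -/
def IsMonohedralBy (T : PlaneTiling) (P : Set Plane) : Prop :=
  ∀ t ∈ T.tiles, ∃ f : Plane ≃ᵢ Plane, t = f '' P

/-- A tiling is periodic if it is invariant under translations in two linearly
independent directions. -/
def IsPeriodic (T : PlaneTiling) : Prop :=
  ∃ v w : Plane, LinearIndependent ℝ ![v, w] ∧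
    (∀ t ∈ T.tiles, (fun x => x + v) '' t ∈ T.tiles) ∧
    (∀ t ∈ T.tiles, (fun x => x + w) '' t ∈ T.tiles)

/-- A tiling is normal if every tile is a closed topological disk, the intersection of
any two tiles is connected (possibly empty), and the tiles are uniformly bounded. -/
def IsNormal (T : PlaneTiling) : Prop :=
  (∀ t ∈ T.tiles, Nonempty (t ≃ₜ (closedBall (0 : Plane) 1))) ∧
  (∀ t₁ ∈ T.tiles, ∀ t₂ ∈ T.tiles, IsPreconnected (t₁ ∩ t₂)) ∧
  (∃ u U : ℝ, 0 < u ∧ u ≤ U ∧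
    ∀ t ∈ T.tiles, (∃ c, closedBall c u ⊆ t) ∧ (∃ c, t ⊆ closedBall c U))

/-- The valence of a point: the number of tiles containing it. -/
def valence (T : PlaneTiling) (x : Plane) : ℕ := {t | t ∈ T.tiles ∧ x ∈ t}.ncard

/-- A vertex of the tiling: a point belonging to at least three tiles. -/
def IsTilingVertex (T : PlaneTiling) (x : Plane) : Prop := 3 ≤ valence T x

/-- An edge of the tiling: the closure of a connected component of the set of points
lying in exactly two tiles. -/
def IsTilingEdge (T : PlaneTiling) (e : Set Plane) : Prop :=
  ∃ x : Plane, valence T x = 2 ∧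
    e = closure (connectedComponentIn {y : Plane | valence T y = 2} x)

/-- Two tiles are adjacent if they share an edge of the tiling. -/
def Adjacent (T : PlaneTiling) (t₁ t₂ : Set Plane) : Prop :=
  t₁ ∈ T.tiles ∧ t₂ ∈ T.tiles ∧ t₁ ≠ t₂ ∧ ∃ e, IsTilingEdge T e ∧ e ⊆ t₁ ∧ e ⊆ t₂

/-- The number of adjacents of a tile. -/
def numAdjacents (T : PlaneTiling) (t : Set Plane) : ℕ := {t' | Adjacent T t t'}.ncard

/-- Tiles meeting the boundary circle of the disk `D(r,M)` but not contained in it. -/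
def boundaryTiles (T : PlaneTiling) (r : ℝ) (M : Plane) : Set (Set Plane) :=
  {t | t ∈ T.tiles ∧ (t ∩ sphere M r).Nonempty ∧ ¬ t ⊆ closedBall M r}

/-- Tiles surrounded by the tiles of `boundaryTiles T r M` but not among them:
they lie in a bounded connected component of the complement of the union of the
boundary tiles. -/
def enclosedTiles (T : PlaneTiling) (r : ℝ) (M : Plane) : Set (Set Plane) :=
  {t | t ∈ T.tiles ∧ t ∉ boundaryTiles T r M ∧
    ∃ x ∈ t, t ⊆ connectedComponentIn (⋃₀ boundaryTiles T r M)ᶜ x ∧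
      Bornology.IsBounded (connectedComponentIn (⋃₀ boundaryTiles T r M)ᶜ x)}

/-- The patch `A(r,M)` of tiles generated by the disk `D(r,M)`. -/
def patch (T : PlaneTiling) (r : ℝ) (M : Plane) : Set (Set Plane) :=
  {t | t ∈ T.tiles ∧ t ⊆ closedBall M r} ∪ boundaryTiles T r M ∪ enclosedTiles T r M

/-- `t(r,M)`: the number of tiles in the patch `A(r,M)`. -/
def tCount (T : PlaneTiling) (r : ℝ) (M : Plane) : ℕ := (patch T r M).ncard

/-- `v(r,M)`: the number of vertices of the tiling in the patch `A(r,M)`. -/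
def vCount (T : PlaneTiling) (r : ℝ) (M : Plane) : ℕ :=
  {x | IsTilingVertex T x ∧ x ∈ ⋃₀ patch T r M}.ncard

/-- `e(r,M)`: the number of edges of the tiling in the patch `A(r,M)`. -/
def eCount (T : PlaneTiling) (r : ℝ) (M : Plane) : ℕ :=
  {e | IsTilingEdge T e ∧ e ⊆ ⋃₀ patch T r M}.ncard

/-- `v_j(r,M)`: the number of vertices of valence `j` in the patch `A(r,M)`. -/
def vjCount (T : PlaneTiling) (j : ℕ) (r : ℝ) (M : Plane) : ℕ :=
  {x | valence T x = j ∧ x ∈ ⋃₀ patch T r M}.ncard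

/-- `t_h(r,M)`: the number of tiles with exactly `h` adjacents in the patch `A(r,M)`. -/
def thCount (T : PlaneTiling) (h : ℕ) (r : ℝ) (M : Plane) : ℕ :=
  {t | t ∈ patch T r M ∧ numAdjacents T t = h}.ncard

/-- A normal tiling is balanced if the limits `v(𝔗)` and `e(𝔗)` exist. -/
def IsBalanced (T : PlaneTiling) : Prop :=
  IsNormal T ∧ ∀ M : Plane,
    (∃ L : ℝ, Tendsto (fun r : ℝ => (vCount T r M : ℝ) / (tCount T r M : ℝ)) atTop (nhds L)) ∧
    (∃ L : ℝ, Tendsto (fun r : ℝ => (eCount T r M : ℝ) / (tCount T r M : ℝ)) atTop (nhds L))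

/-- A normal tiling is strongly balanced if the limits `t_h(𝔗)` and `v_j(𝔗)` exist
for all `h, j ≥ 3`. -/
def IsStronglyBalanced (T : PlaneTiling) : Prop :=
  IsNormal T ∧ ∀ M : Plane, ∀ n : ℕ, 3 ≤ n →
    (∃ L : ℝ, Tendsto (fun r : ℝ => (thCount T n r M : ℝ) / (tCount T r M : ℝ)) atTop (nhds L)) ∧
    (∃ L : ℝ, Tendsto (fun r : ℝ => (vjCount T n r M : ℝ) / (tCount T r M : ℝ)) atTop (nhds L))

/-- The cross product (signed area) of two vectors in the plane. -/
def cross2 (u v : Plane) : ℝ := u 0 * v 1 - u 1 * v 0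

/-- Five points in strictly convex position, listed in cyclic order around the
boundary of their convex hull: every point is extreme (convex independence), and the
turns at consecutive vertices all have the same orientation. -/
def IsConvexPentagon (p : Fin 5 → Plane) : Prop :=
  ConvexIndependent ℝ p ∧
  ∃ ε : ℝ, (ε = 1 ∨ ε = -1) ∧
    ∀ i : Fin 5, 0 < ε * cross2 (p (i + 1) - p i) (p (i + 2) - p (i + 1))

/-- The internal angle of the pentagon with vertices `p` at the vertex `p i`. -/
def pentagonAngle (p : Fin 5 → Plane) (i : Fin 5) : ℝ :=
  EuclideanGeometry.angle (p (i - 1)) (p i) (p (i + 1))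

open MeasureTheory

/-- The cone of directions along which one can leave `x` while staying in `t`. -/
def feasibleCone (t : Set Plane) (x : Plane) : Set Plane :=
  {w | ∃ s : ℝ, 0 < s ∧ x + s • w ∈ t}

/-- The angle of `t` at `x`, as a fraction of the full turn. -/
def angleDensity (t : Set Plane) (x : Plane) : ℝ :=
  volume.real (feasibleCone t x ∩ ball 0 1) / volume.real (ball (0 : Plane) 1)

/-- The directions `w` for which `x` strictly maximizes `cross2 w` over `E`. -/
def strictNormalCone (E : Finset Plane) (x : Plane) : Set Plane :=
  {w | ∀ y ∈ E, y ≠ x → cross2 w y < cross2 w x}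

lemma volumeReal_unitBall_pos : 0 < volume.real (ball (0 : Plane) 1) :=
  ENNReal.toReal_pos (measure_ball_pos volume 0 one_pos).ne' measure_ball_lt_top.ne

lemma cross2_add_right (w a b : Plane) : cross2 w (a + b) = cross2 w a + cross2 w b := by
  simp [cross2]; ring

lemma cross2_smul_right (w : Plane) (c : ℝ) (a : Plane) : cross2 w (c • a) = c * cross2 w a := by
  simp [cross2]; ring

lemma cross2_sub_right (w a b : Plane) : cross2 w (a - b) = cross2 w a - cross2 w b := by
  simp [cross2]; ring

lemma cross2_neg_left (w a : Plane) : cross2 (-w) a = -cross2 w a := by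
  simp [cross2]; ring

lemma cross2_self (w : Plane) : cross2 w w = 0 := by
  simp [cross2]; ring

lemma continuous_cross2_left (a : Plane) : Continuous fun w => cross2 w a := by
  unfold cross2; fun_prop

lemma exists_eq_smul_of_cross2_eq_zero {w a : Plane} (hw : w ≠ 0) (h : cross2 w a = 0) :
    ∃ c : ℝ, a = c • w := by
  unfold cross2 at h
  by_cases h0 : w 0 = 0
  · have h1 : w 1 ≠ 0 := by
      intro h1; apply hw; ext i; fin_cases i <;> simp [h0, h1]
    refine ⟨a 1 / w 1, ?_⟩
    have ha : a 0 = 0 := by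
      rw [h0] at h
      have : w 1 * a 0 = 0 := by linarith
      exact (mul_eq_zero.mp this).resolve_left h1
    ext i; fin_cases i
    · simp [h0, ha]
    · simp [h1]
  · refine ⟨a 0 / w 0, ?_⟩
    ext i; fin_cases i
    · simp [h0]
    · simp; field_simp; linarith

section FeasibleCone

variable {t : Set Plane} {x : Plane}

lemma add_smul_mem_of_le (ht : Convex ℝ t) (hx : x ∈ t) {w : Plane} {s s' : ℝ}
    (hs' : 0 ≤ s') (hle : s' ≤ s) (h : x + s • w ∈ t) : x + s' • w ∈ t := by
  rcases hs'.eq_or_lt with h0 | h0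
  · simpa [← h0] using hx
  have hs : 0 < s := h0.trans_le hle
  have := ht.add_smul_mem hx h (t := s' / s) ⟨by positivity, (div_le_one hs).2 hle⟩
  rwa [smul_smul, div_mul_cancel₀ _ hs.ne'] at this

lemma sub_mem_feasibleCone {y : Plane} (hy : y ∈ t) : y - x ∈ feasibleCone t x :=
  ⟨1, one_pos, by simpa using hy⟩

lemma zero_mem_feasibleCone (hx : x ∈ t) : (0 : Plane) ∈ feasibleCone t x :=
  ⟨1, one_pos, by simpa using hx⟩

lemma smul_mem_feasibleCone {w : Plane} {c : ℝ} (hc : 0 < c)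
    (hw : w ∈ feasibleCone t x) : c • w ∈ feasibleCone t x := by
  obtain ⟨s, hs, h⟩ := hw
  refine ⟨s / c, by positivity, ?_⟩
  rwa [smul_smul, div_mul_cancel₀ _ hc.ne']

lemma add_mem_feasibleCone (ht : Convex ℝ t) (hx : x ∈ t) {v w : Plane}
    (hv : v ∈ feasibleCone t x) (hw : w ∈ feasibleCone t x) : v + w ∈ feasibleCone t x := by
  obtain ⟨a, ha, hv⟩ := hv
  obtain ⟨b, hb, hw⟩ := hw
  have hm : 0 < min a b := lt_min ha hb
  have h1 := add_smul_mem_of_le ht hx hm.le (min_le_left a b) hv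
  have h2 := add_smul_mem_of_le ht hx hm.le (min_le_right a b) hw
  refine ⟨min a b / 2, by positivity, ?_⟩
  have := ht h1 h2 (a := 1 / 2) (b := 1 / 2) (by norm_num) (by norm_num) (by norm_num)
  convert this using 1
  module

lemma mem_or_neg_mem_of_smul_mem_feasibleCone {w : Plane} {c : ℝ} (hc : c ≠ 0)
    (h : c • w ∈ feasibleCone t x) : w ∈ feasibleCone t x ∨ -w ∈ feasibleCone t x := by
  rcases hc.lt_or_gt with hc | hc
  · right
    have := smul_mem_feasibleCone (c := (-c)⁻¹) (inv_pos.2 (by linarith)) h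
    rw [smul_smul] at this
    convert this using 1
    rw [inv_neg, neg_mul, inv_mul_cancel₀ hc.ne, neg_one_smul]
  · left
    have := smul_mem_feasibleCone (c := c⁻¹) (inv_pos.2 hc) h
    rwa [smul_smul, inv_mul_cancel₀ hc.ne', one_smul] at this

lemma feasibleCone_eq_iUnion (ht : Convex ℝ t) (hx : x ∈ t) :
    feasibleCone t x = ⋃ n : ℕ, {w | x + (1 / ((n : ℝ) + 1)) • w ∈ t} := by
  ext w
  simp only [Set.mem_iUnion, Set.mem_ofPred_eq]
  constructor
  · rintro ⟨s, hs, h⟩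
    obtain ⟨n, hn⟩ := exists_nat_one_div_lt hs
    exact ⟨n, add_smul_mem_of_le ht hx (by positivity) hn.le h⟩
  · rintro ⟨n, hn⟩
    exact ⟨_, by positivity, hn⟩

lemma measurableSet_feasibleCone (ht : Convex ℝ t) (hc : IsClosed t) (hx : x ∈ t) :
    MeasurableSet (feasibleCone t x) := by
  rw [feasibleCone_eq_iUnion ht hx]
  refine MeasurableSet.iUnion fun n => IsClosed.measurableSet ?_
  exact hc.preimage (by fun_prop : Continuous fun w : Plane => x + (1 / ((n : ℝ) + 1)) • w)

end FeasibleCone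

lemma volume_inter_eq_zero_of_disjoint_interiors {t₁ t₂ : Set Plane} (h₁ : Convex ℝ t₁)
    (h₂ : Convex ℝ t₂) (h : interior t₁ ∩ interior t₂ = ∅) : volume (t₁ ∩ t₂) = 0 := by
  refine measure_mono_null (t := frontier t₁ ∪ frontier t₂) ?_
    (measure_union_null (h₁.addHaar_frontier _) (h₂.addHaar_frontier _))
  rintro y ⟨hy₁, hy₂⟩
  by_contra hy
  simp only [Set.mem_union, not_or] at hy
  have m₁ : y ∈ interior t₁ := by
    by_contra h'; exact hy.1 ⟨subset_closure hy₁, h'⟩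
  have m₂ : y ∈ interior t₂ := by
    by_contra h'; exact hy.2 ⟨subset_closure hy₂, h'⟩
  exact (Set.eq_empty_iff_forall_notMem.1 h y) ⟨m₁, m₂⟩

lemma volume_feasibleCone_inter_eq_zero {t₁ t₂ : Set Plane} {x : Plane} (h₁ : Convex ℝ t₁)
    (h₂ : Convex ℝ t₂) (hx₁ : x ∈ t₁) (hx₂ : x ∈ t₂) (h : interior t₁ ∩ interior t₂ = ∅) :
    volume (feasibleCone t₁ x ∩ feasibleCone t₂ x) = 0 := by
  have hsub : feasibleCone t₁ x ∩ feasibleCone t₂ x ⊆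
      ⋃ n : ℕ, (fun w : Plane => (1 / ((n : ℝ) + 1)) • w) ⁻¹' ((fun w => x + w) ⁻¹' (t₁ ∩ t₂)) := by
    rintro w ⟨⟨a, ha, hw₁⟩, ⟨b, hb, hw₂⟩⟩
    obtain ⟨n, hn⟩ := exists_nat_one_div_lt (lt_min ha hb)
    rw [Set.mem_iUnion]
    exact ⟨n, add_smul_mem_of_le h₁ hx₁ (by positivity) (hn.le.trans (min_le_left _ _)) hw₁,
      add_smul_mem_of_le h₂ hx₂ (by positivity) (hn.le.trans (min_le_right _ _)) hw₂⟩
  refine measure_mono_null hsub (measure_iUnion_null fun n => ?_)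
  rw [Measure.addHaar_preimage_smul _ (by positivity), measure_preimage_add,
    volume_inter_eq_zero_of_disjoint_interiors h₁ h₂ h, mul_zero]

/-- The angles at a common point of convex sets with disjoint interiors add up to at most one
full turn. -/
lemma sum_angleDensity_le_one (F : Finset (Set Plane)) (x : Plane)
    (hconv : ∀ t ∈ F, Convex ℝ t) (hcl : ∀ t ∈ F, IsClosed t) (hx : ∀ t ∈ F, x ∈ t)
    (hdisj : ∀ t₁ ∈ F, ∀ t₂ ∈ F, t₁ ≠ t₂ → interior t₁ ∩ interior t₂ = ∅) :
    ∑ t ∈ F, angleDensity t x ≤ 1 := by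
  unfold angleDensity
  rw [← Finset.sum_div, div_le_one volumeReal_unitBall_pos]
  have hmeas : ∀ t ∈ F, MeasurableSet (feasibleCone t x ∩ ball 0 1) := fun t ht =>
    (measurableSet_feasibleCone (hconv t ht) (hcl t ht) (hx t ht)).inter measurableSet_ball
  have hU : volume (⋃ t ∈ F, feasibleCone t x ∩ ball 0 1) =
      ∑ t ∈ F, volume (feasibleCone t x ∩ ball 0 1) := by
    refine measure_biUnion_finset₀ ?_ fun t ht => (hmeas t ht).nullMeasurableSet
    intro t₁ h₁ t₂ h₂ hne
    refine measure_mono_null ?_ (volume_feasibleCone_inter_eq_zero (hconv _ h₁) (hconv _ h₂)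
      (hx _ h₁) (hx _ h₂) (hdisj _ h₁ _ h₂ hne))
    exact Set.inter_subset_inter Set.inter_subset_left Set.inter_subset_left
  have hfin : ∀ t ∈ F, volume (feasibleCone t x ∩ ball 0 1) ≠ ⊤ := fun t _ =>
    measure_ne_top_of_subset Set.inter_subset_right measure_ball_lt_top.ne
  simp only [Measure.real]
  rw [← ENNReal.toReal_sum hfin, ← hU]
  refine ENNReal.toReal_mono measure_ball_lt_top.ne (measure_mono ?_)
  exact Set.iUnion₂_subset fun t _ => Set.inter_subset_right

lemma volumeReal_neg_preimage_inter_unitBall (S : Set Plane) :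
    volume.real ((Neg.neg ⁻¹' S) ∩ ball (0 : Plane) 1) = volume.real (S ∩ ball 0 1) := by
  have : (Neg.neg ⁻¹' S) ∩ ball (0 : Plane) 1 = Neg.neg ⁻¹' (S ∩ ball 0 1) := by
    ext w; simp
  rw [this, Measure.real, Measure.measure_preimage_neg, Measure.real]

lemma volumeReal_unitBall_le_of_symmetric_cover {S : Set Plane}
    (h : ∀ w, w ∈ S ∨ -w ∈ S) :
    volume.real (ball (0 : Plane) 1) ≤ 2 * volume.real (S ∩ ball 0 1) := by
  have hsub : ball (0 : Plane) 1 ⊆ (S ∩ ball 0 1) ∪ ((Neg.neg ⁻¹' S) ∩ ball 0 1) := by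
    intro w hw
    exact (h w).imp (fun h => ⟨h, hw⟩) (fun h => ⟨h, hw⟩)
  have hfin : ∀ A : Set Plane, volume (A ∩ ball 0 1) ≠ ⊤ := fun A =>
    measure_ne_top_of_subset Set.inter_subset_right measure_ball_lt_top.ne
  calc volume.real (ball (0 : Plane) 1)
      ≤ volume.real ((S ∩ ball 0 1) ∪ ((Neg.neg ⁻¹' S) ∩ ball 0 1)) :=
        measureReal_mono hsub (measure_union_ne_top (hfin _) (hfin _))
    _ ≤ _ := measureReal_union_le _ _
    _ = _ := by rw [volumeReal_neg_preimage_inter_unitBall]; ring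

/-- A convex set with interior has an angle of at least a half turn at each of its points that is
not extreme. -/
lemma half_le_angleDensity {t : Set Plane} {x : Plane} (ht : Convex ℝ t) (hx : x ∈ t)
    (hinterior : (interior t).Nonempty) (hne : x ∉ t.extremePoints ℝ) :
    1 / 2 ≤ angleDensity t x := by
  rw [angleDensity, le_div_iff₀ volumeReal_unitBall_pos]
  have key : ∀ w, w ∈ feasibleCone t x ∨ -w ∈ feasibleCone t x := by
    rw [mem_extremePoints] at hne
    push Not at hne
    obtain ⟨a, ha, b, hb, hseg, hab⟩ := hne hx
    obtain ⟨α, β, hα, hβ, hαβ, hxab⟩ := hseg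
    set d := a - x with hd
    have hd0 : d ≠ 0 := by
      intro h
      have hax : a = x := sub_eq_zero.1 h
      apply hab hax
      have : β • b = β • x := by
        have hxx : α • x + β • b = α • x + β • x := by
          rw [← add_smul, hαβ, one_smul]; rw [hax] at hxab; exact hxab
        exact add_left_cancel hxx
      exact smul_right_injective _ hβ.ne' this
    have hdT : ∀ c : ℝ, c • d ∈ feasibleCone t x := by
      intro c
      have h1 : d ∈ feasibleCone t x := sub_mem_feasibleCone ha
      have h2 : -d ∈ feasibleCone t x := by
        have := smul_mem_feasibleCone (c := β / α) (by positivity)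
          (sub_mem_feasibleCone (x := x) hb)
        convert this using 1
        have : α • (a - x) + β • (b - x) = 0 := by
          have e : α • (a - x) + β • (b - x) = (α • a + β • b) - (α + β) • x := by module
          rw [e, hxab, hαβ, one_smul, sub_self]
        have h3 : β • (b - x) = -(α • (a - x)) := by rw [eq_neg_iff_add_eq_zero, add_comm, this]
        rw [div_eq_inv_mul, mul_smul, h3, smul_neg, smul_smul, inv_mul_cancel₀ hα.ne', one_smul]
      rcases lt_trichotomy c 0 with hc | hc | hc
      · have := smul_mem_feasibleCone (c := -c) (by linarith) h2
        simpa using this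
      · rw [hc, zero_smul]; exact zero_mem_feasibleCone hx
      · exact smul_mem_feasibleCone hc h1
    obtain ⟨c, hct, hcd⟩ : ∃ c ∈ feasibleCone t x, cross2 d c ≠ 0 := by
      obtain ⟨z, hz⟩ := hinterior
      by_contra! hall
      have hzero : ∀ y ∈ t, cross2 d (y - x) = 0 := fun y hy =>
        hall _ (sub_mem_feasibleCone hy)
      set e : Plane := !₂[-(d 1), d 0] with he
      have hcont : Tendsto (fun s : ℝ => z + s • e) (nhds 0) (nhds (z + (0 : ℝ) • e)) :=
        (by fun_prop : Continuous fun s : ℝ => z + s • e).tendsto 0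
      rw [zero_smul, add_zero] at hcont
      have hev := hcont.eventually (mem_interior_iff_mem_nhds.1 hz)
      have hev' : ∀ᶠ s : ℝ in nhdsWithin 0 (Set.Ioi 0), z + s • e ∈ t :=
        hev.filter_mono nhdsWithin_le_nhds
      obtain ⟨s, hs, hs0⟩ := (hev'.and self_mem_nhdsWithin).exists
      have h1 := hzero _ hs
      have h2 := hzero _ (interior_subset hz)
      rw [cross2_sub_right, cross2_add_right, cross2_smul_right] at h1
      rw [cross2_sub_right] at h2
      have h3 : s * cross2 d e = 0 := by linarith
      have h4 : cross2 d e = 0 := (mul_eq_zero.1 h3).resolve_left (ne_of_gt hs0)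
      simp only [cross2, he, PiLp.toLp_apply, Matrix.cons_val_zero, Matrix.cons_val_one] at h4
      apply hd0
      obtain ⟨h5, h6⟩ := mul_self_add_mul_self_eq_zero.1
        (by linarith : d 0 * d 0 + d 1 * d 1 = 0)
      ext i; fin_cases i <;> simp [h5, h6]
    intro w
    obtain ⟨b', hb'⟩ : ∃ b' : ℝ, w - (cross2 d w / cross2 d c) • c = b' • d := by
      apply exists_eq_smul_of_cross2_eq_zero hd0
      rw [cross2_sub_right, cross2_smul_right, div_mul_cancel₀ _ hcd, sub_self]
    have hw : w = (cross2 d w / cross2 d c) • c + b' • d := by rw [← hb']; abel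
    rcases lt_trichotomy (cross2 d w / cross2 d c) 0 with h0 | h0 | h0
    · right
      have := add_mem_feasibleCone ht hx (smul_mem_feasibleCone (neg_pos.2 h0) hct) (hdT (-b'))
      convert this using 1
      rw [neg_smul, neg_smul, ← neg_add, ← hw]
    · left
      rw [hw, h0, zero_smul, zero_add]; exact hdT b'
    · left
      rw [hw]; exact add_mem_feasibleCone ht hx (smul_mem_feasibleCone h0 hct) (hdT b')
  have := volumeReal_unitBall_le_of_symmetric_cover key
  linarith

lemma isOpen_strictNormalCone (E : Finset Plane) (x : Plane) :
    IsOpen (strictNormalCone E x) := by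
  have : strictNormalCone E x = ⋂ y ∈ E, {w | y ≠ x → cross2 w y < cross2 w x} := by
    ext w; simp [strictNormalCone]
  rw [this]
  refine isOpen_biInter_finset fun y _ => ?_
  by_cases h : y = x
  · simp [h]
  · simpa [h] using isOpen_lt (continuous_cross2_left y) (continuous_cross2_left x)

lemma disjoint_strictNormalCone {E : Finset Plane} {x y : Plane} (hx : x ∈ E) (hy : y ∈ E)
    (h : x ≠ y) : Disjoint (strictNormalCone E x) (strictNormalCone E y) := by
  rw [Set.disjoint_left]
  intro w h1 h2
  exact lt_asymm (h1 y hy h.symm) (h2 x hx h)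

/-- Each direction lies in one of the cones `±feasibleCone`, `±strictNormalCone` of a convex
polygon at a corner. -/
lemma cone_cover {E : Finset Plane} {x : Plane} (hxE : x ∈ E)
    (hind : x ∉ convexHull ℝ ((E : Set Plane) \ {x})) (w : Plane) :
    w ∈ feasibleCone (convexHull ℝ (E : Set Plane)) x ∪ strictNormalCone E x ∨
      -w ∈ feasibleCone (convexHull ℝ (E : Set Plane)) x ∪ strictNormalCone E x := by
  have ht : Convex ℝ (convexHull ℝ (E : Set Plane)) := convex_convexHull ℝ _
  have hE : ∀ y ∈ E, y ∈ convexHull ℝ (E : Set Plane) := fun y hy => subset_convexHull ℝ _ hy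
  have hx := hE x hxE
  by_contra! hcon
  simp only [Set.mem_union, not_or] at hcon
  obtain ⟨⟨hw, hwN⟩, ⟨hnw, hnwN⟩⟩ := hcon
  have hw0 : w ≠ 0 := by rintro rfl; exact hw (zero_mem_feasibleCone hx)
  have hpar : ∀ d ∈ feasibleCone (convexHull ℝ (E : Set Plane)) x, d ≠ 0 → cross2 w d ≠ 0 := by
    intro d hd hd0 h
    obtain ⟨c, rfl⟩ := exists_eq_smul_of_cross2_eq_zero hw0 h
    have hc : c ≠ 0 := by rintro rfl; exact hd0 (zero_smul _ _)
    exact (mem_or_neg_mem_of_smul_mem_feasibleCone hc hd).elim hw hnw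
  simp only [strictNormalCone, Set.mem_ofPred_eq, not_forall, not_lt, cross2_neg_left] at hwN hnwN
  obtain ⟨y, hy, hyx, hy'⟩ := hwN
  obtain ⟨z, hz, hzx, hz'⟩ := hnwN
  have hyc := sub_mem_feasibleCone (x := x) (hE y hy)
  have hzc := sub_mem_feasibleCone (x := x) (hE z hz)
  have hα := hpar _ hyc (sub_ne_zero.2 hyx)
  have hβ := hpar _ hzc (sub_ne_zero.2 hzx)
  set α := cross2 w (y - x) with hαd
  set β := cross2 w (z - x) with hβd
  have hα0 : 0 < α := lt_of_le_of_ne (by rw [hαd, cross2_sub_right]; linarith) hα.symm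
  have hβ0 : 0 < -β :=
    lt_of_le_of_ne (by rw [hβd, cross2_sub_right]; linarith) (neg_ne_zero.2 hβ).symm
  have hd := add_mem_feasibleCone ht hx (smul_mem_feasibleCone hβ0 hyc)
    (smul_mem_feasibleCone hα0 hzc)
  refine hpar _ hd ?_ ?_
  · intro h0
    apply hind
    have hsum : 0 < -β + α := by linarith
    have hxe : x = (-β / (-β + α)) • y + (α / (-β + α)) • z := by
      have h1 : (-β + α) • x = (-β) • y + α • z := by
        have e : (-β) • (y - x) + α • (z - x) = ((-β) • y + α • z) - (-β + α) • x := by module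
        rw [e] at h0
        exact (sub_eq_zero.1 h0).symm
      rw [div_eq_inv_mul, div_eq_inv_mul, mul_smul, mul_smul, ← smul_add, ← h1, smul_smul,
        inv_mul_cancel₀ hsum.ne', one_smul]
    rw [hxe]
    have hyh : y ∈ convexHull ℝ ((E : Set Plane) \ {x}) := subset_convexHull ℝ _ ⟨hy, hyx⟩
    have hzh : z ∈ convexHull ℝ ((E : Set Plane) \ {x}) := subset_convexHull ℝ _ ⟨hz, hzx⟩
    have := (convex_convexHull ℝ ((E : Set Plane) \ {x})) hyh hzh
      (a := -β / (-β + α)) (b := α / (-β + α))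
      (by positivity) (by positivity) (by field_simp)
    exact hxe ▸ this
  · rw [cross2_add_right, cross2_smul_right, cross2_smul_right]
    ring

/-- The angle sum of a convex polygon, as an inequality. -/
lemma angle_sum_lower_bound {E : Finset Plane}
    (hind : ∀ x ∈ E, x ∉ convexHull ℝ ((E : Set Plane) \ {x})) :
    (E.card : ℝ) / 2 - 1 ≤ ∑ x ∈ E, angleDensity (convexHull ℝ (E : Set Plane)) x := by
  set κ := volume.real (ball (0 : Plane) 1) with hκ
  have hκ0 : 0 < κ := volumeReal_unitBall_pos
  have hfin : ∀ A : Set Plane, volume (A ∩ ball 0 1) ≠ ⊤ := fun A =>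
    measure_ne_top_of_subset Set.inter_subset_right measure_ball_lt_top.ne
  have hpt : ∀ x ∈ E, 1 / 2 - volume.real (strictNormalCone E x ∩ ball 0 1) / κ ≤
      angleDensity (convexHull ℝ (E : Set Plane)) x := by
    intro x hx
    have h1 := volumeReal_unitBall_le_of_symmetric_cover (cone_cover hx (hind x hx))
    rw [Set.union_inter_distrib_right] at h1
    have h2 := measureReal_union_le (μ := volume)
      (feasibleCone (convexHull ℝ (E : Set Plane)) x ∩ ball 0 1)
      (strictNormalCone E x ∩ ball 0 1)
    rw [angleDensity, ← hκ, sub_le_iff_le_add, ← add_div, le_div_iff₀ hκ0]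
    linarith
  have hN : ∑ x ∈ E, volume.real (strictNormalCone E x ∩ ball 0 1) ≤ κ := by
    simp only [hκ, Measure.real]
    rw [← ENNReal.toReal_sum fun x _ => hfin _, ← measure_biUnion_finset]
    · exact ENNReal.toReal_mono measure_ball_lt_top.ne
        (measure_mono (Set.iUnion₂_subset fun x _ => Set.inter_subset_right))
    · intro x hx y hy hxy
      exact (disjoint_strictNormalCone hx hy hxy).mono Set.inter_subset_left Set.inter_subset_left
    · exact fun x _ => (isOpen_strictNormalCone E x).measurableSet.inter measurableSet_ball
  refine le_trans ?_ (Finset.sum_le_sum hpt)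
  rw [Finset.sum_sub_distrib, Finset.sum_const, nsmul_eq_mul]
  have : (∑ x ∈ E, volume.real (strictNormalCone E x ∩ ball 0 1)) / κ ≤ 1 :=
    (div_le_one hκ0).2 hN
  rw [Finset.sum_div] at this
  linarith

lemma strictNormalCone_nonempty {E : Finset Plane} {x : Plane}
    (hind : x ∉ convexHull ℝ ((E : Set Plane) \ {x})) : (strictNormalCone E x).Nonempty := by
  obtain ⟨f, u, hfu, hf⟩ := geometric_hahn_banach_closed_point (convex_convexHull ℝ _)
    (Set.Finite.isClosed_convexHull ℝ (E.finite_toSet.subset Set.sdiff_subset)) hind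
  have hrep : ∀ v : Plane, f v = cross2 !₂[f !₂[0, 1], -f !₂[1, 0]] v := by
    intro v
    have hv : v = v 0 • !₂[1, 0] + v 1 • !₂[0, 1] := by
      ext i; fin_cases i <;> simp
    conv_lhs => rw [hv]
    rw [map_add, map_smul, map_smul]
    simp [cross2]; ring
  refine ⟨!₂[f !₂[0, 1], -f !₂[1, 0]], fun y hy hyx => ?_⟩
  rw [← hrep, ← hrep]
  exact (hfu _ (subset_convexHull ℝ _ ⟨hy, hyx⟩)).trans hf

lemma exists_corners_of_isometry {p : Fin 5 → Plane} (hp : ConvexIndependent ℝ p)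
    (f : Plane ≃ᵢ Plane) : ∃ E : Finset Plane, E.card = 5 ∧
      f '' convexHull ℝ (Set.range p) = convexHull ℝ (E : Set Plane) ∧
      ∀ x ∈ E, x ∉ convexHull ℝ ((E : Set Plane) \ {x}) := by
  classical
  set g : Plane →ᵃ[ℝ] Plane := f.toRealAffineIsometryEquiv.toAffineEquiv.toAffineMap with hg
  have hgf : ∀ y, g y = f y := fun y => rfl
  have hinj : Function.Injective fun i => f (p i) := f.injective.comp hp.injective
  have hcoe : ((Finset.univ.image fun i => f (p i) : Finset Plane) : Set Plane) =
      g '' Set.range p := by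
    ext y; simp [hgf]
  refine ⟨Finset.univ.image fun i => f (p i), ?_, ?_, ?_⟩
  · rw [Finset.card_image_of_injective _ hinj]; simp
  · rw [hcoe, ← AffineMap.image_convexHull]; rfl
  · intro x hx
    obtain ⟨i, -, rfl⟩ := Finset.mem_image.1 hx
    have hdiff : g '' Set.range p \ {f (p i)} = g '' (p '' (Set.univ \ {i})) := by
      ext y
      constructor
      · rintro ⟨⟨_, ⟨j, rfl⟩, rfl⟩, hne⟩
        refine ⟨_, ⟨j, ⟨Set.mem_univ _, ?_⟩, rfl⟩, rfl⟩
        rintro rfl; exact hne rfl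
      · rintro ⟨_, ⟨j, ⟨-, hj⟩, rfl⟩, rfl⟩
        exact ⟨⟨_, ⟨j, rfl⟩, rfl⟩, fun h => hj (hinj h)⟩
    rw [hcoe, hdiff, ← AffineMap.image_convexHull]
    rintro ⟨z, hz, hzx⟩
    have : z = p i := f.injective hzx
    exact convexIndependent_iff_notMem_convexHull_sdiff.1 hp i Set.univ (this ▸ hz)

section Tiling

variable {T : PlaneTiling} {u U : ℝ}

/-- Every tile contains a disk of radius `u` and is contained in a disk of radius `U`. -/
def UniformlyBounded (T : PlaneTiling) (u U : ℝ) : Prop :=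
  0 < u ∧ 0 < U ∧
    ∀ t ∈ T.tiles, (∃ c, closedBall c u ⊆ t) ∧ (∃ c, t ⊆ closedBall c U)

/-- `E` assigns to each tile five points in convex position spanning it. -/
def IsCornerMap (T : PlaneTiling) (E : Set Plane → Finset Plane) : Prop :=
  ∀ t ∈ T.tiles, (E t).card = 5 ∧ t = convexHull ℝ (E t : Set Plane) ∧
    ∀ x ∈ E t, x ∉ convexHull ℝ ((E t : Set Plane) \ {x})

lemma IsCornerMap.convex {E : Set Plane → Finset Plane} (hE : IsCornerMap T E) {t : Set Plane}
    (ht : t ∈ T.tiles) : Convex ℝ t := by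
  rw [(hE t ht).2.1]; exact convex_convexHull ℝ _

lemma IsCornerMap.mem {E : Set Plane → Finset Plane} (hE : IsCornerMap T E) {t : Set Plane}
    (ht : t ∈ T.tiles) {x : Plane} (hx : x ∈ E t) : x ∈ t := by
  rw [(hE t ht).2.1]; exact subset_convexHull ℝ _ hx

lemma UniformlyBounded.dist_le (hb : UniformlyBounded T u U) {t : Set Plane} (ht : t ∈ T.tiles)
    {x y : Plane} (hx : x ∈ t) (hy : y ∈ t) : dist x y ≤ 2 * U := by
  obtain ⟨c, hc⟩ := (hb.2.2 t ht).2
  have h1 := mem_closedBall.1 (hc hx)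
  have h2 := mem_closedBall'.1 (hc hy)
  linarith [dist_triangle x c y]

lemma UniformlyBounded.interior_nonempty (hb : UniformlyBounded T u U) {t : Set Plane}
    (ht : t ∈ T.tiles) : (interior t).Nonempty := by
  obtain ⟨c, hc⟩ := (hb.2.2 t ht).1
  exact ⟨c, interior_mono hc (ball_subset_interior_closedBall (mem_ball_self hb.1))⟩

lemma volumeReal_closedBall_plane (x : Plane) {r : ℝ} (hr : 0 ≤ r) :
    volume.real (closedBall x r) = r ^ 2 * volume.real (ball (0 : Plane) 1) := by
  rw [Measure.real, Measure.addHaar_closedBall _ _ hr, ENNReal.toReal_mul,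
    ENNReal.toReal_ofReal (by positivity)]
  simp [Measure.real]

lemma volumeReal_ball_plane (x : Plane) {r : ℝ} (hr : 0 ≤ r) :
    volume.real (ball x r) = r ^ 2 * volume.real (ball (0 : Plane) 1) := by
  rw [Measure.real, Measure.addHaar_ball _ _ hr, ENNReal.toReal_mul,
    ENNReal.toReal_ofReal (by positivity)]
  simp [Measure.real]

/-- Packing bound for the number of tiles inside a region. -/
lemma UniformlyBounded.card_mul_le (hb : UniformlyBounded T u U) {D : Set Plane}
    (hD : volume D ≠ ⊤) (F : Finset (Set Plane)) (hF : ∀ t ∈ F, t ∈ T.tiles ∧ t ⊆ D) :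
    F.card * (u ^ 2 * volume.real (ball (0 : Plane) 1)) ≤ volume.real D := by
  have hle : ∀ t ∈ F, u ^ 2 * volume.real (ball (0 : Plane) 1) ≤ volume.real (interior t) := by
    intro t ht
    obtain ⟨c, hc⟩ := (hb.2.2 t (hF t ht).1).1
    rw [← volumeReal_ball_plane c hb.1.le]
    exact measureReal_mono
      (ball_subset_interior_closedBall.trans (interior_mono hc))
      (measure_ne_top_of_subset (interior_subset.trans (hF t ht).2) hD)
  calc F.card * (u ^ 2 * volume.real (ball (0 : Plane) 1))
      = ∑ t ∈ F, u ^ 2 * volume.real (ball (0 : Plane) 1) := by simp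
    _ ≤ ∑ t ∈ F, volume.real (interior t) := Finset.sum_le_sum hle
    _ = volume.real (⋃ t ∈ F, interior t) := by
        simp only [Measure.real]
        rw [measure_biUnion_finset, ENNReal.toReal_sum]
        · exact fun t ht => measure_ne_top_of_subset (interior_subset.trans (hF t ht).2) hD
        · intro t₁ h₁ t₂ h₂ hne
          exact Set.disjoint_iff_inter_eq_empty.2
            (T.interiors_disjoint _ (hF _ h₁).1 _ (hF _ h₂).1 hne)
        · exact fun t _ => isOpen_interior.measurableSet
    _ ≤ volume.real D := measureReal_mono
        (Set.iUnion₂_subset fun t ht => interior_subset.trans (hF t ht).2) hD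

lemma UniformlyBounded.finite_subset (hb : UniformlyBounded T u U) {D : Set Plane}
    (hD : volume D ≠ ⊤) : {t | t ∈ T.tiles ∧ t ⊆ D}.Finite := by
  by_contra hinf
  have hpos : 0 < u ^ 2 * volume.real (ball (0 : Plane) 1) :=
    mul_pos (pow_pos hb.1 2) volumeReal_unitBall_pos
  obtain ⟨n, hn⟩ := exists_nat_gt (volume.real D / (u ^ 2 * volume.real (ball (0 : Plane) 1)))
  obtain ⟨F, hF, rfl⟩ := Set.Infinite.exists_subset_card_eq hinf n
  have := hb.card_mul_le hD F fun t ht => hF ht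
  rw [div_lt_iff₀ hpos] at hn
  linarith

lemma UniformlyBounded.subset_closedBall (hb : UniformlyBounded T u U) {M : Plane} {R : ℝ}
    {t : Set Plane} (ht : t ∈ T.tiles) (h : (t ∩ closedBall M R).Nonempty) :
    t ⊆ closedBall M (R + 2 * U) := by
  obtain ⟨y, hyt, hy⟩ := h
  intro z hz
  rw [mem_closedBall] at hy ⊢
  linarith [dist_triangle z y M, hb.dist_le ht hz hyt]

lemma UniformlyBounded.finite_inter (hb : UniformlyBounded T u U) (M : Plane) (R : ℝ) :
    {t | t ∈ T.tiles ∧ (t ∩ closedBall M R).Nonempty}.Finite :=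
  (hb.finite_subset (D := closedBall M (R + 2 * U)) measure_closedBall_lt_top.ne).subset
    fun _ ht => ⟨ht.1, hb.subset_closedBall ht.1 ht.2⟩

lemma UniformlyBounded.finite_mem (hb : UniformlyBounded T u U) (x : Plane) :
    {t | t ∈ T.tiles ∧ x ∈ t}.Finite :=
  (hb.finite_inter x 0).subset fun _ ht => ⟨ht.1, x, ht.2, by simp⟩

lemma UniformlyBounded.valence_le (hb : UniformlyBounded T u U) (x : Plane) :
    (valence T x : ℝ) ≤ (2 * U) ^ 2 / u ^ 2 := by
  rw [valence, Set.ncard_eq_toFinset_card _ (hb.finite_mem x)]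
  have h := hb.card_mul_le (D := closedBall x (0 + 2 * U)) measure_closedBall_lt_top.ne
    (hb.finite_mem x).toFinset (fun t ht => by
      have ht' := (hb.finite_mem x).mem_toFinset.1 ht
      exact ⟨ht'.1, hb.subset_closedBall ht'.1 ⟨x, ht'.2, by simp⟩⟩)
  have hU := hb.2.1
  rw [zero_add, volumeReal_closedBall_plane _ (by positivity), ← mul_assoc] at h
  rw [le_div_iff₀ (pow_pos hb.1 2)]
  exact le_of_mul_le_mul_right h volumeReal_unitBall_pos

/-- The feasible cones of the tiles around a point cover all directions. -/
lemma UniformlyBounded.exists_mem_feasibleCone (hb : UniformlyBounded T u U) (x v : Plane) :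
    ∃ t ∈ T.tiles, x ∈ t ∧ v ∈ feasibleCone t x := by
  set K := ⋃₀ {t | (t ∈ T.tiles ∧ (t ∩ closedBall x 1).Nonempty) ∧ x ∉ t} with hK
  have hKc : IsClosed K := by
    rw [hK, Set.sUnion_eq_biUnion]
    exact Set.Finite.isClosed_biUnion ((hb.finite_inter x 1).subset fun t ht => ht.1)
      fun t ht => T.closed t ht.1.1
  have hxK : x ∉ K := by
    rintro ⟨t, ht, hxt⟩; exact ht.2 hxt
  have hcont : Tendsto (fun s : ℝ => x + s • v) (nhds 0) (nhds (x + (0 : ℝ) • v)) :=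
    (by fun_prop : Continuous fun s : ℝ => x + s • v).tendsto 0
  rw [zero_smul, add_zero] at hcont
  have h1 : ∀ᶠ s : ℝ in nhdsWithin 0 (Set.Ioi 0), x + s • v ∈ Kᶜ ∩ closedBall x 1 :=
    (hcont.eventually_mem (inter_mem (hKc.isOpen_compl.mem_nhds hxK)
      (closedBall_mem_nhds x one_pos))).filter_mono nhdsWithin_le_nhds
  obtain ⟨s, ⟨hsK, hsB⟩, hs⟩ := (h1.and self_mem_nhdsWithin).exists
  obtain ⟨t, ht, hst⟩ : x + s • v ∈ ⋃₀ T.tiles := by rw [T.covers]; trivial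
  refine ⟨t, ht, ?_, s, hs, hst⟩
  by_contra hxt
  exact hsK ⟨t, ⟨⟨ht, _, hst, hsB⟩, hxt⟩, hst⟩

lemma notMem_feasibleCone_of_mem_strictNormalCone {E : Finset Plane} {x w : Plane}
    (hw0 : w ≠ 0) (hw : w ∈ strictNormalCone E x) (c : ℝ) (hc : c ≠ 0) :
    c • w ∉ feasibleCone (convexHull ℝ (E : Set Plane)) x := by
  rintro ⟨s, hs, hmem⟩
  have hsub : convexHull ℝ (E : Set Plane) ⊆ {x} ∪ {y | cross2 w y < cross2 w x} := by
    refine convexHull_min ?_ ?_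
    · intro y hy
      by_cases hyx : y = x
      · exact Or.inl hyx
      · exact Or.inr (hw y hy hyx)
    · intro a ha b hb α β hα hβ hαβ
      have hle : ∀ y ∈ ({x} ∪ {y | cross2 w y < cross2 w x} : Set Plane),
          y ≠ x → cross2 w y < cross2 w x := fun y hy hne => hy.resolve_left hne
      have hle' : ∀ y ∈ ({x} ∪ {y | cross2 w y < cross2 w x} : Set Plane),
          cross2 w y ≤ cross2 w x := by
        rintro y (rfl | hy)
        · exact le_rfl
        · exact le_of_lt hy
      by_cases h : α • a + β • b = x
      · exact Or.inl h
      right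
      rw [Set.mem_ofPred_eq, cross2_add_right, cross2_smul_right, cross2_smul_right]
      have ea : α * cross2 w a ≤ α * cross2 w x := mul_le_mul_of_nonneg_left (hle' a ha) hα
      have eb : β * cross2 w b ≤ β * cross2 w x := mul_le_mul_of_nonneg_left (hle' b hb) hβ
      have etot : cross2 w x = α * cross2 w x + β * cross2 w x := by rw [← add_mul, hαβ, one_mul]
      rcases hα.eq_or_lt with hα0 | hα0
      · have hβ1 : β = 1 := by linarith
        have hbx : b ≠ x := by rintro rfl; apply h; simp [← hα0, hβ1]
        have := hle b hb hbx
        simpa [← hα0, hβ1] using this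
      by_cases hax : a = x
      · rcases hβ.eq_or_lt with hβ0 | hβ0
        · exact absurd (by rw [hax, ← hβ0, zero_smul, add_zero, show α = 1 by linarith, one_smul]) h
        · have hbx : b ≠ x := by
            intro hbx; apply h; rw [hax, hbx, ← add_smul, hαβ, one_smul]
          have := mul_lt_mul_of_pos_left (hle b hb hbx) hβ0
          linarith
      · have := mul_lt_mul_of_pos_left (hle a ha hax) hα0
        linarith
  rcases hsub hmem with h | h
  · have : s • c • w = 0 := by simpa using h
    simp [hs.ne', hc, hw0] at this
  · rw [Set.mem_ofPred_eq, cross2_add_right, cross2_smul_right, cross2_smul_right, cross2_self] at h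
    linarith

/-- A corner of a tile belongs to at least three tiles. -/
lemma three_le_valence_of_corner (hb : UniformlyBounded T u U) {E : Set Plane → Finset Plane}
    (hE : IsCornerMap T E) {t : Set Plane} (ht : t ∈ T.tiles) {x : Plane} (hx : x ∈ E t) :
    3 ≤ valence T x := by
  by_contra hlt
  have hind := (hE t ht).2.2 x hx
  have hxt := hE.mem ht hx
  set S := {t' | t' ∈ T.tiles ∧ x ∈ t'} with hS
  have hSfin : S.Finite := hb.finite_mem x
  have huniq : ∀ t₁ ∈ S, ∀ t₂ ∈ S, t₁ ≠ t → t₂ ≠ t → t₁ = t₂ := by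
    intro t₁ h₁ t₂ h₂ hn₁ hn₂
    by_contra hne
    apply hlt
    have hsub : ({t, t₁, t₂} : Set (Set Plane)) ⊆ S := by
      rintro s (rfl | rfl | rfl)
      exacts [⟨ht, hxt⟩, h₁, h₂]
    have := Set.ncard_le_ncard hsub hSfin
    rwa [Set.ncard_eq_three.2 ⟨t, t₁, t₂, hn₁.symm, hn₂.symm, hne, rfl⟩] at this
  obtain ⟨w₀, hw₀⟩ := strictNormalCone_nonempty hind
  have hother : ∀ w ∈ strictNormalCone (E t) x, ∀ c : ℝ, c ≠ 0 → w ≠ 0 →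
      ∃ t' ∈ S, t' ≠ t ∧ c • w ∈ feasibleCone t' x := by
    intro w hw c hc hw0
    obtain ⟨t', ht', hxt', hv⟩ := hb.exists_mem_feasibleCone x (c • w)
    refine ⟨t', ⟨ht', hxt'⟩, ?_, hv⟩
    rintro rfl
    rw [(hE t' ht).2.1] at hv
    exact notMem_feasibleCone_of_mem_strictNormalCone hw0 hw c hc hv
  have hne0 : ∀ w ∈ strictNormalCone (E t) x, w ≠ 0 := by
    rintro w hw rfl
    obtain ⟨y, hy, hyx⟩ := Finset.exists_mem_ne (by rw [(hE t ht).1]; norm_num) x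
    have := hw y hy hyx
    simp [cross2] at this
  obtain ⟨t₂, ht₂, hne₂, hv₂⟩ := hother w₀ hw₀ (-1) (by norm_num) (hne0 w₀ hw₀)
  have hin : ∀ w ∈ strictNormalCone (E t) x, w ∈ feasibleCone t₂ x := by
    intro w hw
    obtain ⟨t', ht', hne', hv'⟩ := hother w hw 1 one_ne_zero (hne0 w hw)
    rw [huniq t' ht' t₂ ht₂ hne' hne₂, one_smul] at hv'
    exact hv'
  have hconv₂ := hE.convex ht₂.1
  obtain ⟨z, hz⟩ := hb.interior_nonempty ht₂.1
  have hcont : Tendsto (fun s : ℝ => w₀ + s • (x - z)) (nhds 0)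
      (nhds (w₀ + (0 : ℝ) • (x - z))) :=
    (by fun_prop : Continuous fun s : ℝ => w₀ + s • (x - z)).tendsto 0
  rw [zero_smul, add_zero] at hcont
  have hev : ∀ᶠ s : ℝ in nhdsWithin 0 (Set.Ioi 0), w₀ + s • (x - z) ∈ strictNormalCone (E t) x :=
    (hcont.eventually_mem ((isOpen_strictNormalCone _ _).mem_nhds hw₀)).filter_mono
      nhdsWithin_le_nhds
  obtain ⟨s, hs, hs0⟩ := (hev.and self_mem_nhdsWithin).exists
  have hs0 : 0 < s := hs0
  obtain ⟨r, hr, hmem⟩ := add_mem_feasibleCone hconv₂ ht₂.2 (hin _ hs) hv₂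
  have hxint : x ∈ interior t₂ := by
    refine hconv₂.openSegment_interior_self_subset_interior hz hmem ?_
    have hrs : 0 < r * s := mul_pos hr hs0
    refine ⟨r * s / (1 + r * s), 1 / (1 + r * s), by positivity, by positivity,
      by field_simp; ring, ?_⟩
    have e : x + r • (w₀ + s • (x - z) + (-1 : ℝ) • w₀) = x + (r * s) • (x - z) := by module
    rw [e]
    have h1 : x = (1 / (1 + r * s)) • ((1 + r * s) • x) := by
      rw [smul_smul, one_div_mul_cancel (by positivity), one_smul]
    conv_rhs => rw [h1]
    rw [div_eq_mul_one_div]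
    module
  have hxcl : x ∈ closure (interior t) := by
    rw [(hE.convex ht).closure_interior_eq_closure_of_nonempty_interior (hb.interior_nonempty ht)]
    exact subset_closure hxt
  obtain ⟨y, hy₂, hy⟩ := mem_closure_iff.1 hxcl _ isOpen_interior hxint
  exact (Set.eq_empty_iff_forall_notMem.1
    (T.interiors_disjoint _ ht₂.1 _ ht hne₂) y) ⟨hy₂, hy⟩

lemma sum_tile_angleDensity_le_one {E : Set Plane → Finset Plane} (hE : IsCornerMap T E)
    {x : Plane} {F : Finset (Set Plane)} (hF : ∀ t ∈ F, t ∈ T.tiles ∧ x ∈ t) :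
    ∑ t ∈ F, angleDensity t x ≤ 1 :=
  sum_angleDensity_le_one F x (fun t ht => hE.convex (hF t ht).1)
    (fun t ht => T.closed t (hF t ht).1) (fun t ht => (hF t ht).2)
    fun _ h₁ _ h₂ => T.interiors_disjoint _ (hF _ h₁).1 _ (hF _ h₂).1

open Classical in
/-- At a point of the plane, the excess of the corner angles over right angles is nonpositive unless
the point has valence `3`. -/
lemma sum_excess_le (hb : UniformlyBounded T u U) {E : Set Plane → Finset Plane}
    (hE : IsCornerMap T E) {x : Plane} {F : Finset (Set Plane)}
    (hF : ∀ t, t ∈ F ↔ t ∈ T.tiles ∧ x ∈ t) :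
    ∑ t ∈ F with x ∈ E t, (4 * angleDensity t x - 1) ≤ if valence T x = 3 then 1 else 0 := by
  rcases (F.filter fun t => x ∈ E t).eq_empty_or_nonempty with hemp | ⟨t₀, ht₀⟩
  · rw [hemp, Finset.sum_empty]; split_ifs <;> norm_num
  rw [Finset.mem_filter] at ht₀
  have h3 : 3 ≤ valence T x := three_le_valence_of_corner hb hE ((hF t₀).1 ht₀.1).1 ht₀.2
  have hval : valence T x = F.card := by
    rw [valence, ← Set.ncard_coe_finset]
    congr 1; ext t; exact (hF t).symm
  have htot := sum_tile_angleDensity_le_one hE fun t ht => (hF t).1 ht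
  rw [← Finset.sum_filter_add_sum_filter_not F (fun t => x ∈ E t)] at htot
  have hcard := Finset.card_filter_add_card_filter_not (s := F) (fun t => x ∈ E t)
  have hflat : ((F.filter fun t => x ∉ E t).card : ℝ) * (1 / 2) ≤
      ∑ t ∈ F with x ∉ E t, angleDensity t x := by
    rw [← nsmul_eq_mul]
    refine Finset.card_nsmul_le_sum _ _ _ fun t ht => ?_
    rw [Finset.mem_filter] at ht
    obtain ⟨htT, hxt⟩ := (hF t).1 ht.1
    refine half_le_angleDensity (hE.convex htT) hxt (hb.interior_nonempty htT) fun hext => ht.2 ?_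
    rw [(hE t htT).2.1] at hext
    exact extremePoints_convexHull_subset hext
  have hsum : ∑ t ∈ F with x ∈ E t, (4 * angleDensity t x - 1) =
      4 * ∑ t ∈ F with x ∈ E t, angleDensity t x - (F.filter fun t => x ∈ E t).card := by
    rw [Finset.sum_sub_distrib, ← Finset.mul_sum]; simp
  have hcard' : ((F.filter fun t => x ∈ E t).card : ℝ) + (F.filter fun t => x ∉ E t).card =
      valence T x := by rw [hval]; exact_mod_cast hcard
  have hnn : (0 : ℝ) ≤ (F.filter fun t => x ∉ E t).card := Nat.cast_nonneg _
  rw [hsum]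
  split_ifs with h
  · have : (valence T x : ℝ) = 3 := by exact_mod_cast h
    linarith
  · have : (4 : ℝ) ≤ valence T x := by exact_mod_cast (by omega : 4 ≤ valence T x)
    linarith

open Classical in
/-- Discharging bound: up to corners on the rim of a finite set of tiles, there are at least as many
corners of valence `3` as tiles. -/
lemma card_le_rim_add_three_valent (hb : UniformlyBounded T u U) {E : Set Plane → Finset Plane}
    (hE : IsCornerMap T E) {A : Finset (Set Plane)} (hA : ∀ t ∈ A, t ∈ T.tiles) :
    (A.card : ℝ) ≤
      4 * ((A.biUnion E).filter fun x => ∃ t ∈ T.tiles, x ∈ t ∧ t ∉ A).card +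
        ((A.biUnion E).filter fun x => valence T x = 3).card := by
  have htile : ∀ t ∈ A, (1 : ℝ) ≤ ∑ x ∈ E t, (4 * angleDensity t x - 1) := by
    intro t ht
    obtain ⟨hc, heq, hind⟩ := hE t (hA t ht)
    have := angle_sum_lower_bound hind
    rw [← heq, hc] at this
    rw [Finset.sum_sub_distrib, ← Finset.mul_sum, Finset.sum_const, hc]
    norm_num at this ⊢
    linarith
  calc (A.card : ℝ) = ∑ t ∈ A, 1 := by simp
    _ ≤ ∑ t ∈ A, ∑ x ∈ E t, (4 * angleDensity t x - 1) := Finset.sum_le_sum htile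
    _ = ∑ x ∈ A.biUnion E, ∑ t ∈ A with x ∈ E t, (4 * angleDensity t x - 1) := by
        refine Finset.sum_comm' fun t x => ?_
        simp only [Finset.mem_filter, Finset.mem_biUnion]
        exact ⟨fun h => ⟨h, t, h⟩, fun h => h.1⟩
    _ ≤ ∑ x ∈ A.biUnion E, (4 * (if ∃ t ∈ T.tiles, x ∈ t ∧ t ∉ A then 1 else 0) +
          if valence T x = 3 then 1 else 0) := by
        refine Finset.sum_le_sum fun x _ => ?_
        by_cases hrim : ∃ t ∈ T.tiles, x ∈ t ∧ t ∉ A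
        · rw [if_pos hrim, Finset.sum_sub_distrib, ← Finset.mul_sum]
          have h1 := sum_tile_angleDensity_le_one hE (x := x) (F := A.filter fun t => x ∈ E t)
            fun t ht => by
              rw [Finset.mem_filter] at ht
              exact ⟨hA t ht.1, hE.mem (hA t ht.1) ht.2⟩
          have h2 : (0 : ℝ) ≤ ∑ t ∈ A with x ∈ E t, 1 :=
            Finset.sum_nonneg fun _ _ => zero_le_one
          have h3 : (0 : ℝ) ≤ if valence T x = 3 then 1 else 0 := by split_ifs <;> norm_num
          linarith
        · rw [if_neg hrim, mul_zero, zero_add]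
          push Not at hrim
          have hS := sum_excess_le hb hE (x := x) (F := A.filter fun t => x ∈ t) fun t => by
            rw [Finset.mem_filter]
            exact ⟨fun h => ⟨hA t h.1, h.2⟩, fun h => ⟨hrim t h.1 h.2, h.2⟩⟩
          rw [Finset.filter_filter] at hS
          have heq : (A.filter fun t => x ∈ E t) = A.filter fun t => x ∈ t ∧ x ∈ E t :=
            Finset.filter_congr fun t ht => ⟨fun h => ⟨hE.mem (hA t ht) h, h⟩, fun h => h.2⟩
          rw [heq]
          exact hS
    _ = _ := by
        rw [Finset.sum_add_distrib, ← Finset.mul_sum]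
        simp

lemma enclosedTiles_subset_closedBall (hb : UniformlyBounded T u U) {r : ℝ} (hr : 0 ≤ r)
    {M : Plane} {t : Set Plane} (ht : t ∈ enclosedTiles T r M) :
    t ⊆ closedBall M (r + 2 * U) := by
  obtain ⟨htT, -, x, hxt, hsub, hbdd⟩ := ht
  have hU := hb.2.1
  intro y hy
  by_contra hyM
  rw [mem_closedBall, not_le, dist_eq_norm] at hyM
  have hrim : ⋃₀ boundaryTiles T r M ⊆ closedBall M (r + 2 * U) := by
    refine Set.sUnion_subset fun s hs => hb.subset_closedBall hs.1 ?_
    exact hs.2.1.mono (Set.inter_subset_inter_right _ sphere_subset_closedBall)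
  set ray : Set Plane := (fun s : ℝ => y + s • (y - M)) '' Set.Ici 0 with hray
  have hnorm : ∀ s : ℝ, 0 ≤ s → ‖y + s • (y - M) - M‖ = (1 + s) * ‖y - M‖ := by
    intro s hs
    rw [show y + s • (y - M) - M = (1 + s) • (y - M) by module, norm_smul,
      Real.norm_of_nonneg (by linarith)]
  have hpre : IsPreconnected ray := isPreconnected_Ici.image _ (by fun_prop)
  have hyray : y ∈ ray := ⟨0, Set.self_mem_Ici, by simp⟩
  have hcompl : ray ⊆ (⋃₀ boundaryTiles T r M)ᶜ := by
    rintro _ ⟨s, hs, rfl⟩ hmem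
    have h1 := hrim hmem
    rw [mem_closedBall, dist_eq_norm, hnorm s hs] at h1
    have hs' : 0 ≤ s := hs
    nlinarith [norm_nonneg (y - M)]
  have hcomp := hpre.subset_connectedComponentIn hyray hcompl
  rw [← connectedComponentIn_eq (hsub hy)] at hcomp
  obtain ⟨R, hR⟩ := (hbdd.subset hcomp).subset_closedBall M
  have hpos : 0 < ‖y - M‖ := by linarith
  have hs : 0 ≤ |R| / ‖y - M‖ := by positivity
  have h2 := hR ⟨|R| / ‖y - M‖, hs, rfl⟩
  rw [mem_closedBall, dist_eq_norm, hnorm _ hs, add_mul, div_mul_cancel₀ _ hpos.ne'] at h2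
  linarith [le_abs_self R]

lemma patch_subset_closedBall (hb : UniformlyBounded T u U) {r : ℝ} (hr : 0 ≤ r) {M : Plane}
    {t : Set Plane} (ht : t ∈ patch T r M) : t ∈ T.tiles ∧ t ⊆ closedBall M (r + 2 * U) := by
  have hU := hb.2.1
  rcases ht with (ht | ht) | ht
  · exact ⟨ht.1, ht.2.trans (closedBall_subset_closedBall (by linarith))⟩
  · exact ⟨ht.1, hb.subset_closedBall ht.1
      (ht.2.1.mono (Set.inter_subset_inter_right _ sphere_subset_closedBall))⟩
  · exact ⟨ht.1, enclosedTiles_subset_closedBall hb hr ht⟩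

lemma patch_finite (hb : UniformlyBounded T u U) {r : ℝ} (hr : 0 ≤ r) (M : Plane) :
    (patch T r M).Finite :=
  (hb.finite_subset (D := closedBall M (r + 2 * U)) measure_closedBall_lt_top.ne).subset
    fun _ ht => patch_subset_closedBall hb hr ht

lemma mem_patch_of_dist_le (hb : UniformlyBounded T u U) {r : ℝ} {M x : Plane}
    {t : Set Plane} (ht : t ∈ T.tiles) (hx : x ∈ t) (hxM : dist x M ≤ r - 2 * U) :
    t ∈ patch T r M := by
  refine Or.inl (Or.inl ⟨ht, ?_⟩)
  have := hb.subset_closedBall ht ⟨x, hx, mem_closedBall.2 hxM⟩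
  rwa [sub_add_cancel] at this

lemma tCount_lower_bound (hb : UniformlyBounded T u U) {r : ℝ} (hr : 2 * U ≤ r) (M : Plane) :
    (r - 2 * U) ^ 2 ≤ tCount T r M * U ^ 2 := by
  have hU := hb.2.1
  have hfin := patch_finite hb (by linarith : 0 ≤ r) M
  have hcov : closedBall M (r - 2 * U) ⊆ ⋃ t ∈ hfin.toFinset, t := by
    intro x hx
    obtain ⟨t, ht, hxt⟩ : x ∈ ⋃₀ T.tiles := by rw [T.covers]; trivial
    exact Set.mem_iUnion₂.2 ⟨t, hfin.mem_toFinset.2 (mem_patch_of_dist_le hb ht hxt hx), hxt⟩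
  have hvol : ∀ t ∈ hfin.toFinset, volume t ≠ ⊤ ∧
      volume.real t ≤ U ^ 2 * volume.real (ball (0 : Plane) 1) := by
    intro t ht
    obtain ⟨c, hc⟩ :=
      (hb.2.2 t (patch_subset_closedBall hb (by linarith) (hfin.mem_toFinset.1 ht)).1).2
    rw [← volumeReal_closedBall_plane c hU.le]
    exact ⟨measure_ne_top_of_subset hc measure_closedBall_lt_top.ne,
      measureReal_mono hc measure_closedBall_lt_top.ne⟩
  refine le_of_mul_le_mul_right ?_ volumeReal_unitBall_pos
  calc (r - 2 * U) ^ 2 * volume.real (ball (0 : Plane) 1)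
      = volume.real (closedBall M (r - 2 * U)) :=
        (volumeReal_closedBall_plane M (by linarith)).symm
    _ ≤ volume.real (⋃ t ∈ hfin.toFinset, t) := measureReal_mono hcov
        (measure_biUnion_lt_top hfin.toFinset.finite_toSet
          fun t ht => (hvol t ht).1.lt_top).ne
    _ ≤ ∑ t ∈ hfin.toFinset, volume.real t := measureReal_biUnion_finset_le _ _
    _ ≤ ∑ t ∈ hfin.toFinset, U ^ 2 * volume.real (ball (0 : Plane) 1) :=
        Finset.sum_le_sum fun t ht => (hvol t ht).2
    _ = tCount T r M * U ^ 2 * volume.real (ball (0 : Plane) 1) := by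
        rw [Finset.sum_const, nsmul_eq_mul, tCount, Set.ncard_eq_toFinset_card _ hfin, mul_assoc]

open Classical in
lemma card_rim_le (hb : UniformlyBounded T u U) {E : Set Plane → Finset Plane}
    (hE : IsCornerMap T E) {r : ℝ} (hr : 4 * U ≤ r) (M : Plane) {A : Finset (Set Plane)}
    (hA : ∀ t, t ∈ A ↔ t ∈ patch T r M) :
    (((A.biUnion E).filter fun x => ∃ t ∈ T.tiles, x ∈ t ∧ t ∉ A).card : ℝ) * u ^ 2 ≤
      80 * U * r := by
  have hU := hb.2.1
  set D := closedBall M (r + 4 * U) \ ball M (r - 4 * U) with hD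
  have hDtop : volume D ≠ ⊤ :=
    measure_ne_top_of_subset Set.sdiff_subset measure_closedBall_lt_top.ne
  have hfin := hb.finite_subset hDtop
  have hDvol : volume.real D = 16 * U * r * volume.real (ball (0 : Plane) 1) := by
    rw [hD, measureReal_sdiff (ball_subset_closedBall.trans
        (closedBall_subset_closedBall (by linarith))) measurableSet_ball
        measure_closedBall_lt_top.ne,
      volumeReal_closedBall_plane _ (by linarith), volumeReal_ball_plane M (by linarith)]
    ring
  have hcard := hb.card_mul_le hDtop hfin.toFinset fun t ht => hfin.mem_toFinset.1 ht
  rw [hDvol, ← mul_assoc] at hcard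
  replace hcard := le_of_mul_le_mul_right hcard volumeReal_unitBall_pos
  have hsub : ((A.biUnion E).filter fun x => ∃ t ∈ T.tiles, x ∈ t ∧ t ∉ A) ⊆
      hfin.toFinset.biUnion E := by
    intro x hx
    rw [Finset.mem_filter, Finset.mem_biUnion] at hx
    obtain ⟨⟨t, htA, hxE⟩, t', ht', hxt', hnot⟩ := hx
    obtain ⟨htT, htsub⟩ := patch_subset_closedBall hb (by linarith) ((hA t).1 htA)
    have hfar : r - 2 * U < dist x M := by
      by_contra! hle
      exact hnot ((hA t').2 (mem_patch_of_dist_le hb ht' hxt' hle))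
    rw [Finset.mem_biUnion]
    refine ⟨t, hfin.mem_toFinset.2 ⟨htT, fun y hy => ⟨?_, ?_⟩⟩, hxE⟩
    · exact closedBall_subset_closedBall (by linarith) (htsub hy)
    · rw [mem_ball, not_lt]
      linarith [dist_triangle x y M, hb.dist_le htT (hE.mem htT hxE) hy]
  have hle : ((A.biUnion E).filter fun x => ∃ t ∈ T.tiles, x ∈ t ∧ t ∉ A).card ≤
      hfin.toFinset.card * 5 :=
    (Finset.card_le_card hsub).trans (Finset.card_biUnion_le_card_mul _ _ _ fun t ht =>
      (hE t (hfin.mem_toFinset.1 ht).1).1.le)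
  have hle' : (((A.biUnion E).filter fun x => ∃ t ∈ T.tiles, x ∈ t ∧ t ∉ A).card : ℝ) ≤
      hfin.toFinset.card * 5 := by exact_mod_cast hle
  nlinarith [mul_le_mul_of_nonneg_right hle' (sq_nonneg u)]

lemma exists_corner_of_three_le_valence (hb : UniformlyBounded T u U)
    {E : Set Plane → Finset Plane} (hE : IsCornerMap T E) {x : Plane} (hx : 3 ≤ valence T x) :
    ∃ t ∈ T.tiles, x ∈ t ∧ x ∈ E t := by
  by_contra! hno
  have hfin := hb.finite_mem x
  have htot := sum_tile_angleDensity_le_one hE (x := x) (F := hfin.toFinset)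
    fun t ht => hfin.mem_toFinset.1 ht
  have hflat : (hfin.toFinset.card : ℝ) * (1 / 2) ≤ ∑ t ∈ hfin.toFinset, angleDensity t x := by
    rw [← nsmul_eq_mul]
    refine Finset.card_nsmul_le_sum _ _ _ fun t ht => ?_
    obtain ⟨htT, hxt⟩ := hfin.mem_toFinset.1 ht
    refine half_le_angleDensity (hE.convex htT) hxt (hb.interior_nonempty htT)
      fun hext => hno t htT hxt ?_
    rw [(hE t htT).2.1] at hext
    exact extremePoints_convexHull_subset hext
  rw [valence, Set.ncard_eq_toFinset_card _ hfin] at hx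
  have : (3 : ℝ) ≤ hfin.toFinset.card := by exact_mod_cast hx
  linarith

lemma finite_three_valent_in_patch (hb : UniformlyBounded T u U) {E : Set Plane → Finset Plane}
    (hE : IsCornerMap T E) {r : ℝ} (hr : 0 ≤ r) (M : Plane) :
    {x | valence T x = 3 ∧ x ∈ ⋃₀ patch T r M}.Finite := by
  refine ((hb.finite_inter M (r + 2 * U)).biUnion fun t _ => (E t).finite_toSet).subset ?_
  rintro x ⟨hx, s, hs, hxs⟩
  obtain ⟨t, ht, hxt, hxE⟩ := exists_corner_of_three_le_valence hb hE hx.ge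
  exact Set.mem_biUnion ⟨ht, x, hxt, (patch_subset_closedBall hb hr hs).2 hxs⟩ hxE

/-- For large radii at least half as many vertices of valence `3` as tiles lie in the patch. -/
lemma half_le_three_valent_ratio (hb : UniformlyBounded T u U) {E : Set Plane → Finset Plane}
    (hE : IsCornerMap T E) {r : ℝ} (hr : 4 * U ≤ r) (hr' : 2560 * U ^ 3 ≤ r * u ^ 2) (M : Plane) :
    (1 : ℝ) / 2 ≤ (vjCount T 3 r M : ℝ) / tCount T r M := by
  classical
  have hU := hb.2.1
  have hu := hb.1
  have hr0 : 0 < r := by linarith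
  have hfin := patch_finite hb hr0.le M
  have hmem : ∀ t, t ∈ hfin.toFinset ↔ t ∈ patch T r M := fun t => hfin.mem_toFinset
  have hrim := card_rim_le hb hE hr M hmem
  have hmain := card_le_rim_add_three_valent hb hE (A := hfin.toFinset) fun t ht =>
    (patch_subset_closedBall hb hr0.le ((hmem t).1 ht)).1
  have hlow := tCount_lower_bound hb (by linarith : 2 * U ≤ r) M
  rw [← Set.ncard_eq_toFinset_card _ hfin] at hmain
  change (tCount T r M : ℝ) ≤ _ at hmain
  set n : ℝ := (tCount T r M : ℝ) with hn
  set m : ℝ := (((hfin.toFinset.biUnion E).filter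
    fun x => ∃ t ∈ T.tiles, x ∈ t ∧ t ∉ hfin.toFinset).card : ℝ) with hm
  have hthree : (((hfin.toFinset.biUnion E).filter fun x => valence T x = 3).card : ℝ) ≤
      vjCount T 3 r M := by
    rw [vjCount, ← Set.ncard_coe_finset]
    refine Nat.cast_le.2 (Set.ncard_le_ncard ?_ (finite_three_valent_in_patch hb hE hr0.le M))
    intro x hx
    rw [Finset.mem_coe, Finset.mem_filter, Finset.mem_biUnion] at hx
    obtain ⟨⟨t, ht, hxt⟩, hv⟩ := hx
    have htp := (hmem t).1 ht
    exact ⟨hv, t, htp, hE.mem (patch_subset_closedBall hb hr0.le htp).1 hxt⟩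
  have hnr : r ^ 2 / 4 ≤ n * U ^ 2 := by nlinarith
  have hnpos : 0 < n := by
    by_contra! h
    nlinarith [sq_nonneg U, pow_pos hr0 2]
  have hsmall : 8 * m ≤ n := by
    refine le_of_mul_le_mul_right ?_ (by positivity : 0 < u ^ 2 * U ^ 2)
    calc 8 * m * (u ^ 2 * U ^ 2) = 8 * (m * u ^ 2) * U ^ 2 := by ring
      _ ≤ 8 * (80 * U * r) * U ^ 2 := by gcongr
      _ = (2560 * U ^ 3) * r / 4 := by ring
      _ ≤ (r * u ^ 2) * r / 4 := by gcongr
      _ = u ^ 2 * (r ^ 2 / 4) := by ring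
      _ ≤ u ^ 2 * (n * U ^ 2) := by gcongr
      _ = n * (u ^ 2 * U ^ 2) := by ring
  rw [le_div_iff₀ hnpos]
  linarith

end Tiling

/-- Every strongly balanced tiling of the plane by isometric copies
of a single convex pentagon contains a vertex of valence `3`; indeed `w₃(𝔗) > 0`. -/
theorem stronglyBalanced_pentagon_exists_three_valent_vertex
    (p : Fin 5 → Plane) (hp : IsConvexPentagon p) (T : PlaneTiling)
    (hmono : IsMonohedralBy T (convexHull ℝ (Set.range p)))
    (hnorm : IsNormal T) (tl vl : ℕ → ℝ)
    (htl : ∀ M : Plane, ∀ h : ℕ, 3 ≤ h →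
      Tendsto (fun r : ℝ => (thCount T h r M : ℝ) / (tCount T r M : ℝ)) atTop (nhds (tl h)))
    (hvl : ∀ M : Plane, ∀ j : ℕ, 3 ≤ j →
      Tendsto (fun r : ℝ => (vjCount T j r M : ℝ) / (tCount T r M : ℝ)) atTop (nhds (vl j))) :
    (∃ x : Plane, valence T x = 3) ∧
      0 < vl 3 / ∑' k : {n : ℕ // 3 ≤ n}, vl (k : ℕ) := by
  obtain ⟨u, U, hu, huU, hball⟩ := hnorm.2.2
  have hb : UniformlyBounded T u U := ⟨hu, hu.trans_le huU, hball⟩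
  have hcorner : ∀ t ∈ T.tiles, ∃ E : Finset Plane, E.card = 5 ∧
      t = convexHull ℝ (E : Set Plane) ∧ ∀ x ∈ E, x ∉ convexHull ℝ ((E : Set Plane) \ {x}) := by
    intro t ht
    obtain ⟨f, hf⟩ := hmono t ht
    rw [hf]
    exact exists_corners_of_isometry hp.1 f
  choose! E hE using hcorner
  have hratio : ∀ᶠ r : ℝ in atTop,
      (1 : ℝ) / 2 ≤ (vjCount T 3 r 0 : ℝ) / (tCount T r 0 : ℝ) := by
    filter_upwards [eventually_ge_atTop (4 * U), eventually_ge_atTop (2560 * U ^ 3 / u ^ 2)]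
      with r hr hr'
    exact half_le_three_valent_ratio hb hE hr ((div_le_iff₀ (by positivity)).1 hr') 0
  have hthree : (1 : ℝ) / 2 ≤ vl 3 := ge_of_tendsto (hvl 0 3 le_rfl) hratio
  have hnonneg : ∀ j, 3 ≤ j → 0 ≤ vl j := fun j hj =>
    ge_of_tendsto (hvl 0 j hj) (Eventually.of_forall fun r => by positivity)
  have hvanish : ∀ j : ℕ, 3 ≤ j → (2 * U) ^ 2 / u ^ 2 < j → vl j = 0 := by
    intro j hj hlt
    have hcount : ∀ r, vjCount T j r 0 = 0 := by
      intro r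
      have hempty : {x | valence T x = j ∧ x ∈ ⋃₀ patch T r 0} = ∅ := by
        refine Set.eq_empty_of_forall_notMem fun x hx => ?_
        have hle := hb.valence_le x
        rw [hx.1] at hle
        linarith
      rw [vjCount, hempty, Set.ncard_empty]
    have hlim := hvl 0 j hj
    simp only [hcount, Nat.cast_zero, zero_div] at hlim
    exact tendsto_nhds_unique hlim tendsto_const_nhds
  obtain ⟨N, hN⟩ := exists_nat_gt ((2 * U) ^ 2 / u ^ 2)
  have hsummable : Summable fun k : {n : ℕ // 3 ≤ n} => vl (k : ℕ) := by
    refine summable_of_hasFiniteSupport (Set.Finite.subset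
      (Set.Finite.preimage Subtype.val_injective.injOn (Set.finite_lt_nat N)) fun k hk => ?_)
    by_contra hkN
    refine hk (hvanish k k.2 (hN.trans_le ?_))
    exact_mod_cast not_lt.1 hkN
  refine ⟨?_, div_pos (by linarith) ?_⟩
  · obtain ⟨r, hr⟩ := hratio.exists
    by_contra! hno
    have hempty : {x | valence T x = 3 ∧ x ∈ ⋃₀ patch T r 0} = ∅ :=
      Set.eq_empty_of_forall_notMem fun x hx => hno x hx.1
    rw [vjCount, hempty, Set.ncard_empty, Nat.cast_zero, zero_div] at hr
    norm_num at hr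
  · have hle := hsummable.le_tsum ⟨3, le_rfl⟩ fun k _ => hnonneg k k.2
    linarith
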